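/- Let k ≥ 2 and m ≥ 1 be integers. The set P_{k−2,m} of jointly holomorphic functions G : ℍ×ℂ → ℂ satisfying G|_m X = G for all X ∈ ℤ² and H_m^{k−1} G = 0 is a complex vector space of dimension 2m(k−1). -/

import Mathlib

open Complex

noncomputable section

/-- Holomorphic Wirtinger derivative. -/
def wder (f : ℂ → ℂ) (w : ℂ) : ℂ :=
  (fderiv ℝ f w 1 - Complex.I * fderiv ℝ f w Complex.I) / 2

/-- The index-`m` heat operator `H_m = 8πim ∂_τ − ∂_z²`. -/
def heatOp (m : ℕ) (F : ℂ → ℂ → ℂ) : ℂ → ℂ → ℂ :=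
  fun τ z => 8 * (Real.pi : ℂ) * Complex.I * (m : ℂ) * wder (fun w => F w z) τ
    - wder (wder (F τ)) z

/-- The index-`m` elliptic slash operator `F ↦ F|_m X` for `X = (λ,μ) ∈ ℤ²`. -/
def ellSlash (m : ℕ) (X : ℤ × ℤ) (F : ℂ → ℂ → ℂ) : ℂ → ℂ → ℂ :=
  fun τ z =>
    Complex.exp (2 * (Real.pi : ℂ) * Complex.I * (m : ℂ) *
      ((X.1 : ℂ) ^ 2 * τ + 2 * (X.1 : ℂ) * z + (X.2 : ℂ) * (X.1 : ℂ))) *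
    F τ (z + (X.1 : ℂ) * τ + (X.2 : ℂ))

/-- The space `P_{k−2,m}`: jointly holomorphic functions on `ℍ×ℂ`, invariant under
the elliptic slash action of `ℤ²` and annihilated by `H_m^{k−1}`. -/
def Pkm (k m : ℕ) : Set (ℂ → ℂ → ℂ) :=
  {G | DifferentiableOn ℂ (fun p : ℂ × ℂ => G p.1 p.2) {p : ℂ × ℂ | 0 < p.1.im} ∧
    (∀ X : ℤ × ℤ, ∀ τ z : ℂ, 0 < τ.im → ellSlash m X G τ z = G τ z) ∧
    (∀ τ z : ℂ, 0 < τ.im → (heatOp m)^[k - 1] G τ z = 0)}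

/-! ### Fourier coefficients of one-periodic functions -/

/-- The `n`-th Fourier coefficient of `g` along the real axis. -/
def fcoef (g : ℂ → ℂ) (n : ℤ) : ℂ :=
  ∫ x in (0 : ℝ)..1, g x * cexp (-(2 * Real.pi * I * n * x))

theorem integral_exp_two_pi_mul_I (n : ℤ) :
    ∫ x in (0 : ℝ)..1, cexp (2 * Real.pi * I * n * x) = if n = 0 then 1 else 0 := by
  split_ifs with h
  · simp [h]
  · have hc : (2 * Real.pi * I * n : ℂ) ≠ 0 := by
      simp [h, Real.pi_ne_zero]
    rw [integral_exp_mul_complex hc]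
    have : cexp (2 * Real.pi * I * n * (1 : ℝ)) = 1 :=
      Complex.exp_eq_one_iff.2 ⟨n, by push_cast; ring⟩
    rw [this]
    simp

theorem fcoef_const_mul (c : ℂ) (g : ℂ → ℂ) (n : ℤ) :
    fcoef (fun z => c * g z) n = c * fcoef g n := by
  unfold fcoef
  rw [← intervalIntegral.integral_const_mul]
  simp only [mul_assoc]

theorem fcoef_sub {f g : ℂ → ℂ} (hf : Continuous f) (hg : Continuous g) (n : ℤ) :
    fcoef (fun z => f z - g z) n = fcoef f n - fcoef g n := by
  unfold fcoef
  rw [← intervalIntegral.integral_sub]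
  · simp only [sub_mul]
  all_goals exact Continuous.intervalIntegrable (by fun_prop) _ _

theorem fcoef_sum {ι : Type*} (s : Finset ι) {f : ι → ℂ → ℂ} (hf : ∀ i, Continuous (f i)) (n : ℤ) :
    fcoef (fun z => ∑ i ∈ s, f i z) n = ∑ i ∈ s, fcoef (f i) n := by
  unfold fcoef
  rw [← intervalIntegral.integral_finsetSum]
  · simp only [Finset.sum_mul]
  · intro i _
    have := hf i
    exact Continuous.intervalIntegrable (by fun_prop) _ _

theorem eq_zero_of_fcoef_eq_zero {g : ℂ → ℂ} (hg : Differentiable ℂ g)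
    (hper : ∀ z, g (z + 1) = g z) (h0 : ∀ n, fcoef g n = 0) (z : ℂ) : g z = 0 := by
  have : Fact (0 < (1 : ℝ)) := ⟨one_pos⟩
  have hp : Function.Periodic (fun x : ℝ => g x) 1 := fun x => by simpa using hper x
  let F : C(AddCircle (1 : ℝ), ℂ) :=
    ⟨hp.lift, continuous_coinduced_dom.2 (hg.continuous.comp continuous_ofReal)⟩
  have hF : ∀ x : ℝ, F (x : AddCircle (1 : ℝ)) = g x := fun x => hp.lift_coe x
  have hc : fourierCoeff F = 0 := by
    ext n
    rw [fourierCoeff_eq_intervalIntegral F n 0]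
    simp only [Pi.zero_apply]
    rw [← h0 n, fcoef]
    simp only [fourier_coe_apply, hF]
    simp only [div_one, zero_add, one_smul, smul_eq_mul, ofReal_one]
    congr 1
    ext x
    rw [mul_comm]
    congr 2
    push_cast
    ring
  have hreal : ∀ x : ℝ, g x = 0 := by
    intro x
    have hs := has_pointwise_sum_fourier_series_of_summable (f := F)
      (by rw [hc]; exact summable_zero) (x : AddCircle (1 : ℝ))
    rw [hc, hF] at hs
    simp only [Pi.zero_apply, zero_smul] at hs
    exact hs.unique hasSum_zero
  have han : AnalyticOnNhd ℂ g Set.univ := fun w _ => hg.analyticAt w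
  have hfr : ∃ᶠ w in nhdsWithin (0 : ℂ) {0}ᶜ, g w = (fun _ => (0 : ℂ)) w := by
    have ht : Filter.Tendsto (fun x : ℝ => (x : ℂ)) (nhdsWithin 0 {0}ᶜ)
        (nhdsWithin (0 : ℂ) {0}ᶜ) := by
      apply tendsto_nhdsWithin_of_tendsto_nhds_of_eventually_within
      · exact (continuous_ofReal.tendsto' 0 0 (by simp)).mono_left nhdsWithin_le_nhds
      · filter_upwards [self_mem_nhdsWithin] with x hx
        simpa using hx
    exact ht.frequently (Filter.Eventually.frequently (Filter.Eventually.of_forall hreal))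
  exact congrFun (han.eq_of_frequently_eq (fun w _ => analyticAt_const) hfr) z

/-- The integral of an entire one-periodic function over a period is unchanged by translation. -/
theorem integral_add_const_of_periodic {g : ℂ → ℂ} (hg : Differentiable ℂ g)
    (hper : ∀ z, g (z + 1) = g z) (w : ℂ) :
    ∫ x in (0 : ℝ)..1, g (x + w) = ∫ x in (0 : ℝ)..1, g x := by
  obtain ⟨P, hP⟩ := hg.isExactOn_univ
  have hP' : ∀ z, HasDerivAt P (g z) z := fun z => hP z trivial
  have key : ∀ v : ℂ, ∫ x in (0 : ℝ)..1, g (x + v) = P (v + 1) - P v := by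
    intro v
    rw [intervalIntegral.integral_eq_sub_of_hasDerivAt (f := fun x : ℝ => P (x + v))]
    · simp [add_comm]
    · intro x _
      have h2 : HasDerivAt (fun y : ℂ => P (y + v)) (g ((x : ℂ) + v)) (x : ℂ) :=
        (hP' _).comp_add_const (x : ℂ) v
      exact h2.comp_ofReal
    · have := hg.continuous
      exact Continuous.intervalIntegrable (by fun_prop) _ _
  have hd : ∀ v, HasDerivAt (fun v => P (v + 1) - P v) 0 v := by
    intro v
    have := ((hP' (v + 1)).comp_add_const v 1).sub (hP' v)
    rwa [hper, sub_self] at this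
  have hconst := is_const_of_deriv_eq_zero (fun v => (hd v).differentiableAt)
    (fun v => (hd v).deriv) w 0
  have h0 := key 0
  simp only [add_zero] at h0
  rw [key w, h0]
  simpa using hconst

theorem fcoef_quasiperiodic {g : ℂ → ℂ} (hg : Differentiable ℂ g) (hper : ∀ z, g (z + 1) = g z)
    {m : ℕ} (hm : 1 ≤ m) {τ : ℂ}
    (hq : ∀ z, cexp (2 * Real.pi * I * m * (τ + 2 * z)) * g (z + τ) = g z) (n : ℤ) :
    fcoef g (n + 2 * m) * cexp (-(Real.pi * I * ((n + 2 * m : ℤ) : ℂ) ^ 2 * τ / (2 * m))) =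
      fcoef g n * cexp (-(Real.pi * I * (n : ℂ) ^ 2 * τ / (2 * m))) := by
  have hm0 : (m : ℂ) ≠ 0 := by exact_mod_cast (by omega : m ≠ 0)
  have hinv := integral_add_const_of_periodic
    (g := fun z => g z * cexp (-(2 * Real.pi * I * n * z))) (by fun_prop) (by
      intro z
      rw [hper]
      congr 1
      rw [Complex.exp_eq_exp_iff_exists_int]
      exact ⟨-n, by push_cast; ring⟩) τ
  have h1 : fcoef g (n + 2 * m) = cexp (2 * Real.pi * I * (m + n) * τ) * fcoef g n := by
    rw [fcoef, fcoef, ← hinv, ← intervalIntegral.integral_const_mul]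
    congr 1
    ext x
    rw [← hq x]
    push_cast
    rw [mul_left_comm, mul_right_comm, mul_comm _ (g _)]
    congr 1
    rw [← Complex.exp_add, ← Complex.exp_add]
    congr 1
    ring
  rw [h1, mul_right_comm, mul_comm _ (fcoef g n), ← Complex.exp_add]
  congr 2
  push_cast
  field_simp
  ring

theorem eq_of_add_two_mul_eq {b : ℤ → ℂ} {m : ℕ} (h : ∀ n, b (n + 2 * m) = b n)
    (n l : ℤ) : b (n + 2 * m * l) = b n := by
  have : Function.Periodic b (2 * m) := h
  simpa [mul_comm] using (this.int_mul l) n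

/-! ### Holomorphic dependence on the parameter -/

theorem isOpen_im_pos : IsOpen {τ : ℂ | 0 < τ.im} :=
  isOpen_lt continuous_const Complex.continuous_im

theorem isOpen_fst_im_pos : IsOpen {p : ℂ × ℂ | 0 < p.1.im} :=
  isOpen_lt continuous_const (Complex.continuous_im.comp continuous_fst)

theorem differentiable_slice {F : ℂ → ℂ → ℂ}
    (hF : DifferentiableOn ℂ (fun p : ℂ × ℂ => F p.1 p.2) {p : ℂ × ℂ | 0 < p.1.im})
    {τ : ℂ} (hτ : 0 < τ.im) : Differentiable ℂ (F τ) := fun z =>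
  (((hF.differentiableAt (isOpen_fst_im_pos.mem_nhds (x := (τ, z)) hτ)).hasFDerivAt).comp z
    (hasFDerivAt_prodMk_right τ z)).differentiableAt

theorem differentiableOn_integral_param {F : ℂ → ℂ → ℂ}
    (hF : DifferentiableOn ℂ (fun p : ℂ × ℂ => F p.1 p.2) {p : ℂ × ℂ | 0 < p.1.im}) :
    DifferentiableOn ℂ (fun τ => ∫ x in (0 : ℝ)..1, F τ x) {τ | 0 < τ.im} := by
  intro τ hτ
  apply DifferentiableAt.differentiableWithinAt
  set G : ℂ × ℂ → ℂ := fun p => F p.1 p.2 with hG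
  have hGd : ∀ w z : ℂ, 0 < w.im → DifferentiableAt ℂ G (w, z) := fun w z hw =>
    hF.differentiableAt (isOpen_fst_im_pos.mem_nhds (x := (w, z)) hw)
  have hGw : ∀ w z : ℂ, 0 < w.im →
      HasDerivAt (fun w => F w z) (fderiv ℂ G (w, z) (1, 0)) w := fun w z hw => by
    have := ((hGd w z hw).hasFDerivAt.comp w (hasFDerivAt_prodMk_left w z)).hasDerivAt
    exact this.congr_deriv (by simp)
  obtain ⟨R, hR, hball⟩ := Metric.isOpen_iff.1 isOpen_im_pos τ hτ
  have hsub : Metric.closedBall τ (R / 2) ⊆ {τ | 0 < τ.im} :=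
    (Metric.closedBall_subset_ball (by linarith)).trans hball
  obtain ⟨M, hM⟩ := ((isCompact_closedBall τ (R / 2)).prod
    (isCompact_Icc (a := (0 : ℝ)) (b := 1))).exists_bound_of_continuousOn
    (f := fun p : ℂ × ℝ => F p.1 p.2) (by
      intro p hp
      have h1 : ContinuousAt G (p.1, (p.2 : ℂ)) := (hGd _ _ (hsub hp.1)).continuousAt
      exact (ContinuousAt.comp (g := G) (f := fun p : ℂ × ℝ => (p.1, (p.2 : ℂ))) h1
        (by fun_prop)).continuousWithinAt)
  have hcont : ∀ w : ℂ, 0 < w.im → Continuous fun x : ℝ => F w x := fun w hw =>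
    (differentiable_slice hF hw).continuous.comp continuous_ofReal
  refine (intervalIntegral.hasDerivAt_integral_of_dominated_loc_of_deriv_le
    (F := fun w (x : ℝ) => F w x) (F' := fun w (x : ℝ) => fderiv ℂ G (w, x) (1, 0))
    (bound := fun _ => M / (R / 4)) (s := Metric.ball τ (R / 4))
    (Metric.ball_mem_nhds τ (by positivity)) ?_ ?_ ?_ ?_ ?_ ?_).2.differentiableAt
  · filter_upwards [isOpen_im_pos.mem_nhds hτ] with w hw
    exact (hcont w hw).aestronglyMeasurable
  · exact (hcont τ hτ).intervalIntegrable _ _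
  · refine Measurable.aestronglyMeasurable ?_
    exact (measurable_fderiv_apply_const ℂ G (1, 0)).comp
      (measurable_const.prodMk measurable_ofReal)
  · refine Filter.Eventually.of_forall fun x hx w hw => ?_
    rw [Set.uIoc_of_le zero_le_one] at hx
    have hcl : ∀ u ∈ Metric.closedBall w (R / 4), u ∈ Metric.closedBall τ (R / 2) := by
      intro u hu
      rw [Metric.mem_closedBall] at hu ⊢
      rw [Metric.mem_ball] at hw
      linarith [dist_triangle u w τ]
    have hwim : 0 < w.im := hsub (hcl w (Metric.mem_closedBall_self (by positivity)))
    rw [← (hGw w x hwim).deriv]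
    refine Complex.norm_deriv_le_of_forall_mem_sphere_norm_le (by positivity) ?_ ?_
    · refine DifferentiableOn.diffContOnCl_ball (U := {τ | 0 < τ.im}) ?_ (fun u hu => hsub (hcl u hu))
      exact fun u hu => (hGw u x hu).differentiableAt.differentiableWithinAt
    · intro u hu
      exact hM (u, x) ⟨hcl u (Metric.sphere_subset_closedBall hu), ⟨hx.1.le, hx.2⟩⟩
  · exact intervalIntegrable_const
  · refine Filter.Eventually.of_forall fun x _ w hw => hGw w x ?_
    exact hsub (Metric.ball_subset_closedBall (Metric.ball_subset_ball (by linarith) hw))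

theorem differentiableOn_fcoef {F : ℂ → ℂ → ℂ}
    (hF : DifferentiableOn ℂ (fun p : ℂ × ℂ => F p.1 p.2) {p : ℂ × ℂ | 0 < p.1.im}) (n : ℤ) :
    DifferentiableOn ℂ (fun τ => fcoef (F τ) n) {τ | 0 < τ.im} :=
  differentiableOn_integral_param (F := fun τ z => F τ z * cexp (-(2 * Real.pi * I * n * z)))
    (hF.mul (by fun_prop))

/-! ### Theta functions -/

/-- The `z`-derivative of `jacobiTheta₂'` is `4πi` times the `τ`-derivative of `jacobiTheta₂`. -/
theorem hasDerivAt_jacobiTheta₂' (z : ℂ) {τ : ℂ} (hτ : 0 < τ.im) :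
    HasDerivAt (fun w => jacobiTheta₂' w τ)
      (4 * Real.pi * I * jacobiTheta₂_fderiv z τ (0, 1)) z := by
  obtain ⟨S, hz⟩ := exists_gt |z.im|
  have hU : IsOpen {w : ℂ | |w.im| < S} :=
    (continuous_abs.comp continuous_im).isOpen_preimage _ isOpen_Iio
  have hd : ∀ n : ℤ, Differentiable ℂ fun w => jacobiTheta₂'_term n w τ := by
    intro n
    unfold jacobiTheta₂'_term jacobiTheta₂_term
    fun_prop
  have hu := (summable_pow_mul_jacobiTheta₂_term_bound S hτ 1).mul_left (2 * Real.pi)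
  have hle : ∀ (n : ℤ) (w : ℂ), w ∈ {w : ℂ | |w.im| < S} → ‖jacobiTheta₂'_term n w τ‖ ≤
      2 * Real.pi * (|n| ^ 1 * Real.exp (-Real.pi * (τ.im * n ^ 2 - 2 * S * |n|))) := by
    intro n w hw
    refine (norm_jacobiTheta₂'_term_le hτ (le_of_lt hw) le_rfl n).trans (le_of_eq ?_)
    push_cast
    ring
  have hs := hasSum_deriv_of_summable_norm hu (fun n => (hd n).differentiableOn) hU hle
    (z := z) hz
  have hdiff : DifferentiableAt ℂ (fun w => jacobiTheta₂' w τ) z :=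
    (differentiableOn_tsum_of_summable_norm hu (fun n => (hd n).differentiableOn) hU
      hle).differentiableAt (hU.mem_nhds hz)
  refine hdiff.hasDerivAt.congr_deriv (HasSum.unique hs ?_)
  have h2 := ((ContinuousLinearMap.apply ℂ ℂ ((0 : ℂ), (1 : ℂ))).hasSum
    (hasSum_jacobiTheta₂_term_fderiv z hτ)).mul_left (4 * Real.pi * I)
  refine h2.congr_fun ?_
  intro n
  have h3 : HasDerivAt (fun w => jacobiTheta₂'_term n w τ)
      (2 * Real.pi * I * n * (jacobiTheta₂_term n z τ * (2 * Real.pi * I * n))) z := by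
    unfold jacobiTheta₂'_term jacobiTheta₂_term
    refine HasDerivAt.const_mul _ (HasDerivAt.cexp ?_)
    simpa using ((hasDerivAt_id z).const_mul (2 * Real.pi * I * (n : ℂ))).add_const
      (Real.pi * I * (n : ℂ) ^ 2 * τ)
  rw [h3.deriv]
  simp [jacobiTheta₂_term_fderiv, jacobiTheta₂_term]
  ring

theorem jacobiTheta₂_fderiv_apply (z : ℂ) {τ : ℂ} (hτ : 0 < τ.im) (a b : ℂ) :
    jacobiTheta₂_fderiv z τ (a, b) =
      a * jacobiTheta₂' z τ + b * jacobiTheta₂_fderiv z τ (0, 1) := by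
  have h1 : jacobiTheta₂_fderiv z τ (1, 0) = jacobiTheta₂' z τ := by
    have := ((hasFDerivAt_jacobiTheta₂ z hτ).comp z (hasFDerivAt_prodMk_left z τ)).hasDerivAt
    simpa using this.unique (hasDerivAt_jacobiTheta₂_fst z hτ)
  rw [← h1, ← smul_eq_mul, ← smul_eq_mul, ← map_smul, ← map_smul, ← map_add]
  simp

theorem jacobiTheta₂_add_int (z τ : ℂ) (n : ℤ) : jacobiTheta₂ (z + n) τ = jacobiTheta₂ z τ := by
  have : Function.Periodic (fun z => jacobiTheta₂ z τ) 1 := fun z => jacobiTheta₂_add_left z τ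
  simpa using (this.int_mul n) z

theorem jacobiTheta₂_add_int_mul (z τ : ℂ) (n : ℤ) :
    jacobiTheta₂ (z + n * τ) τ =
      cexp (-(Real.pi * I * (n ^ 2 * τ + 2 * n * z))) * jacobiTheta₂ z τ := by
  induction n using Int.induction_on with
  | zero => simp
  | succ n ih =>
    have h := jacobiTheta₂_add_left' (z + n * τ) τ
    push_cast at ih ⊢
    rw [add_mul, one_mul, ← add_assoc, h, ih, ← mul_assoc, ← Complex.exp_add]
    congr 2
    ring
  | pred n ih =>
    have h := jacobiTheta₂_add_left' (z + (-n - 1) * τ) τ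
    push_cast at ih ⊢
    rw [show z + (-n - 1) * τ + τ = z + -n * τ by ring, ih] at h
    have h' := congrArg (fun t => cexp (Real.pi * I * (τ + 2 * (z + (-n - 1) * τ))) * t) h
    simp only [← mul_assoc, ← Complex.exp_add] at h'
    rw [show (Real.pi * I * (τ + 2 * (z + (-n - 1) * τ)) + -Real.pi * I *
      (τ + 2 * (z + (-n - 1) * τ)) : ℂ) = 0 by ring, Complex.exp_zero, one_mul] at h'
    rw [← h']
    congr 2
    ring

/-- The theta function `θ_{m,ν}(τ,z) = ∑_{n ≡ ν mod 2m} q^{n²/4m} ζ^n`. -/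
def thetaFn (m ν : ℕ) (τ z : ℂ) : ℂ :=
  cexp (Real.pi * I * ν ^ 2 / (2 * m) * τ + 2 * Real.pi * I * ν * z) *
    jacobiTheta₂ (ν * τ + 2 * m * z) (2 * m * τ)

theorem im_two_mul_pos {m : ℕ} (hm : 1 ≤ m) {τ : ℂ} (hτ : 0 < τ.im) : 0 < (2 * m * τ : ℂ).im := by
  have : (0 : ℝ) < m := by exact_mod_cast hm
  have h : (2 * m * τ : ℂ).im = 2 * m * τ.im := by simp
  rw [h]
  positivity

theorem differentiableOn_thetaFn {m : ℕ} (hm : 1 ≤ m) (ν : ℕ) :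
    DifferentiableOn ℂ (fun p : ℂ × ℂ => thetaFn m ν p.1 p.2) {p : ℂ × ℂ | 0 < p.1.im} := by
  intro p hp
  have h := (hasFDerivAt_jacobiTheta₂ (ν * p.1 + 2 * m * p.2)
    (im_two_mul_pos hm hp)).differentiableAt
  have h2 := DifferentiableAt.comp (g := fun p : ℂ × ℂ => jacobiTheta₂ p.1 p.2) p
    (f := fun p : ℂ × ℂ => ((ν * p.1 + 2 * m * p.2 : ℂ), (2 * m * p.1 : ℂ))) h (by fun_prop)
  refine DifferentiableAt.differentiableWithinAt ?_
  exact DifferentiableAt.mul (by fun_prop) h2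

theorem thetaFn_slash (m ν : ℕ) (X : ℤ × ℤ) (τ z : ℂ) :
    ellSlash m X (thetaFn m ν) τ z = thetaFn m ν τ z := by
  obtain ⟨l, μ⟩ := X
  have harg : (ν * τ + 2 * m * (z + l * τ + μ) : ℂ) =
      ν * τ + 2 * m * z + l * (2 * m * τ) + ((2 * m * μ : ℤ) : ℂ) := by
    push_cast
    ring
  simp only [ellSlash, thetaFn]
  rw [harg, jacobiTheta₂_add_int, jacobiTheta₂_add_int_mul, ← mul_assoc, ← mul_assoc,
    ← Complex.exp_add, ← Complex.exp_add]
  congr 1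
  rw [Complex.exp_eq_exp_iff_exists_int]
  refine ⟨ν * μ + m * μ * l, ?_⟩
  push_cast
  ring

theorem hasDerivAt_thetaFn_tau {m : ℕ} (hm : 1 ≤ m) (ν : ℕ) {τ : ℂ} (hτ : 0 < τ.im) (z : ℂ) :
    ∃ d, HasDerivAt (fun w => thetaFn m ν w z) d τ ∧
      deriv (deriv (thetaFn m ν τ)) z = 8 * Real.pi * I * m * d := by
  have hm0 : (m : ℂ) ≠ 0 := by exact_mod_cast (by omega : m ≠ 0)
  have hτ' := im_two_mul_pos hm hτ
  set A : ℂ := Real.pi * I * ν ^ 2 / (2 * m) with hA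
  set B : ℂ := 2 * Real.pi * I * ν with hB
  have hlin : ∀ a b x : ℂ, HasDerivAt (fun x => a * x + b) a x := fun a b x => by
    simpa using ((hasDerivAt_id x).const_mul a).add_const b
  have hlin' : ∀ a b x : ℂ, HasDerivAt (fun x => b + a * x) a x := fun a b x => by
    simpa using ((hasDerivAt_id x).const_mul a).const_add b
  have hE : ∀ y, HasDerivAt (fun y => cexp (A * τ + B * y)) (cexp (A * τ + B * y) * B) y :=
    fun y => (hlin' B (A * τ) y).cexp
  have hJ : ∀ y, HasDerivAt (fun y => jacobiTheta₂ (ν * τ + 2 * m * y) (2 * m * τ))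
      (jacobiTheta₂' (ν * τ + 2 * m * y) (2 * m * τ) * (2 * m)) y := fun y =>
    HasDerivAt.comp (h₂ := fun w => jacobiTheta₂ w (2 * m * τ)) y
      (hasDerivAt_jacobiTheta₂_fst (ν * τ + 2 * m * y) hτ') (hlin' (2 * m) (ν * τ) y)
  have hJ' : ∀ y, HasDerivAt (fun y => jacobiTheta₂' (ν * τ + 2 * m * y) (2 * m * τ))
      (4 * Real.pi * I * jacobiTheta₂_fderiv (ν * τ + 2 * m * y) (2 * m * τ) (0, 1) * (2 * m)) y :=
    fun y =>
      HasDerivAt.comp (h₂ := fun w => jacobiTheta₂' w (2 * m * τ)) y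
        (hasDerivAt_jacobiTheta₂' (ν * τ + 2 * m * y) hτ') (hlin' (2 * m) (ν * τ) y)
  have h1 : ∀ y, HasDerivAt (thetaFn m ν τ) _ y := fun y => (hE y).mul (hJ y)
  have h2 := (((hE z).mul_const B).mul (hJ z)).add ((hE z).mul ((hJ' z).mul_const (2 * m : ℂ)))
  have hJτ : HasDerivAt (fun w => jacobiTheta₂ (ν * w + 2 * m * z) (2 * m * w))
      (jacobiTheta₂_fderiv (ν * τ + 2 * m * z) (2 * m * τ) (ν, 2 * m)) τ := by
    refine HasFDerivAt.comp_hasDerivAt (l := fun p : ℂ × ℂ => jacobiTheta₂ p.1 p.2) τ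
      (f := fun w => (ν * w + 2 * m * z, 2 * m * w)) (hasFDerivAt_jacobiTheta₂ _ hτ') ?_
    refine (hlin _ _ τ).prodMk ?_
    simpa using hlin (2 * m) 0 τ
  refine ⟨_, ((hlin A (B * z) τ).cexp).mul hJτ, ?_⟩
  rw [funext fun y => (h1 y).deriv]
  refine h2.deriv.trans ?_
  rw [jacobiTheta₂_fderiv_apply _ hτ' ν (2 * m), hA, hB]
  field_simp
  ring

theorem fcoef_thetaFn {m : ℕ} (hm : 1 ≤ m) (ν : ℕ) {τ : ℂ} (hτ : 0 < τ.im) (n : ℤ) :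
    fcoef (thetaFn m ν τ) n =
      if (2 * m : ℤ) ∣ n - ν then cexp (Real.pi * I * (n : ℂ) ^ 2 * τ / (2 * m)) else 0 := by
  have hm0 : (m : ℂ) ≠ 0 := by exact_mod_cast (by omega : m ≠ 0)
  set A : ℤ → ℂ := fun l => cexp (Real.pi * I * (ν + 2 * m * l : ℂ) ^ 2 * τ / (2 * m)) with hA
  have hAJ : ∀ (l : ℤ) (z : ℂ), cexp (Real.pi * I * ν ^ 2 / (2 * m) * τ + 2 * Real.pi * I * ν * z) *
      jacobiTheta₂_term l (ν * τ + 2 * m * z) (2 * m * τ) * cexp (-(2 * Real.pi * I * n * z)) =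
      A l * cexp (2 * Real.pi * I * (ν + 2 * m * l - n : ℤ) * z) := by
    intro l z
    simp only [hA, jacobiTheta₂_term, ← Complex.exp_add]
    congr 1
    push_cast
    field_simp
    ring
  have hJ : ∀ z, HasSum (fun l => A l * cexp (2 * Real.pi * I * (ν + 2 * m * l - n : ℤ) * z))
      (thetaFn m ν τ z * cexp (-(2 * Real.pi * I * n * z))) := by
    intro z
    have := ((hasSum_jacobiTheta₂_term (ν * τ + 2 * m * z) (im_two_mul_pos hm hτ)).mul_left
      (cexp (Real.pi * I * ν ^ 2 / (2 * m) * τ + 2 * Real.pi * I * ν * z))).mul_right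
      (cexp (-(2 * Real.pi * I * n * z)))
    simp only [hAJ] at this
    exact this
  have hsum : Summable fun l => ‖A l‖ := by
    have := (hJ 0).summable.norm
    simpa using this
  have hnorm : ∀ (l : ℤ) (x : ℝ),
      ‖A l * cexp (2 * Real.pi * I * (ν + 2 * m * l - n : ℤ) * x)‖ = ‖A l‖ := by
    intro l x
    rw [norm_mul, show (2 * Real.pi * I * (ν + 2 * m * l - n : ℤ) * x : ℂ) =
      ((2 * Real.pi * (ν + 2 * m * l - n : ℤ) * x : ℝ) : ℂ) * I by push_cast; ring,
      Complex.norm_exp_ofReal_mul_I, mul_one]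
  have hint := intervalIntegral.hasSum_integral_of_dominated_convergence
    (μ := MeasureTheory.volume) (a := 0) (b := 1)
    (F := fun (l : ℤ) (x : ℝ) => A l * cexp (2 * Real.pi * I * (ν + 2 * m * l - n : ℤ) * x))
    (f := fun x : ℝ => thetaFn m ν τ x * cexp (-(2 * Real.pi * I * n * x)))
    (fun l _ => ‖A l‖) (fun l => Continuous.aestronglyMeasurable (by fun_prop))
    (fun l => Filter.Eventually.of_forall fun x _ => (hnorm l x).le)
    (Filter.Eventually.of_forall fun _ _ => hsum) intervalIntegrable_const
    (Filter.Eventually.of_forall fun x _ => hJ x)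
  simp only [intervalIntegral.integral_const_mul, integral_exp_two_pi_mul_I] at hint
  refine hint.unique ?_
  split_ifs with h
  · obtain ⟨l, hl⟩ := h
    have hl' : n = ν + 2 * m * l := by omega
    have key : A l * (if (ν + 2 * m * l - n : ℤ) = 0 then 1 else 0) =
        cexp (Real.pi * I * (n : ℂ) ^ 2 * τ / (2 * m)) := by
      rw [if_pos (by omega), mul_one, hA, hl']
      push_cast
      rfl
    rw [← key]
    refine hasSum_single l fun l' hne => ?_
    rw [if_neg, mul_zero]
    intro h0
    refine hne ?_
    have h1 : (2 * m : ℤ) * l' = 2 * m * l := by omega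
    exact mul_left_cancel₀ (by omega) h1
  · convert! hasSum_zero using 2 with l
    rw [if_neg, mul_zero]
    intro h0
    exact h ⟨l, by omega⟩

theorem differentiable_thetaFn {m : ℕ} (hm : 1 ≤ m) (ν : ℕ) {τ : ℂ} (hτ : 0 < τ.im) :
    Differentiable ℂ (thetaFn m ν τ) :=
  differentiable_slice (differentiableOn_thetaFn hm ν) hτ

theorem fcoef_sum_thetaFn {m : ℕ} (hm : 1 ≤ m) (g : Fin (2 * m) → ℂ) {τ : ℂ} (hτ : 0 < τ.im)
    (ν : Fin (2 * m)) (l : ℤ) :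
    fcoef (fun z => ∑ i, g i * thetaFn m i τ z) (ν + 2 * m * l) =
      g ν * cexp (Real.pi * I * ((ν + 2 * m * l : ℤ) : ℂ) ^ 2 * τ / (2 * m)) := by
  rw [fcoef_sum (f := fun i z => g i * thetaFn m i τ z) _ fun i =>
    continuous_const.mul (differentiable_thetaFn hm i hτ).continuous]
  simp only [fcoef_const_mul, fcoef_thetaFn hm _ hτ]
  rw [Finset.sum_eq_single ν]
  · rw [if_pos ⟨l, by ring⟩]
  · intro i _ hi
    rw [if_neg, mul_zero]
    rintro ⟨q, hq⟩
    apply hi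
    have h1 : ((i : ℕ) : ℤ) % ((2 * m : ℕ) : ℤ) = ((ν : ℕ) : ℤ) % ((2 * m : ℕ) : ℤ) := by
      rw [Int.emod_eq_emod_iff_emod_sub_eq_zero]
      exact Int.emod_eq_zero_of_dvd ⟨l - q, by push_cast; linarith⟩
    have h2 : (i : ℕ) % (2 * m) = (ν : ℕ) % (2 * m) := by exact_mod_cast h1
    rw [Nat.mod_eq_of_lt i.2, Nat.mod_eq_of_lt ν.2] at h2
    exact Fin.ext h2
  · simp

theorem sum_thetaFn_injective {m : ℕ} (hm : 1 ≤ m) {g g' : Fin (2 * m) → ℂ} {τ : ℂ}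
    (hτ : 0 < τ.im)
    (h : ∀ z, ∑ i, g i * thetaFn m i τ z = ∑ i, g' i * thetaFn m i τ z) : g = g' := by
  ext ν
  have h1 := fcoef_sum_thetaFn hm g hτ ν 0
  rw [funext h, fcoef_sum_thetaFn hm g' hτ ν 0] at h1
  exact (mul_right_cancel₀ (Complex.exp_ne_zero _) h1).symm

/-- Theta decomposition. -/
theorem exists_eq_sum_thetaFn {m : ℕ} (hm : 1 ≤ m) {G : ℂ → ℂ → ℂ}
    (hG : DifferentiableOn ℂ (fun p : ℂ × ℂ => G p.1 p.2) {p : ℂ × ℂ | 0 < p.1.im})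
    (hs : ∀ X : ℤ × ℤ, ∀ τ z : ℂ, 0 < τ.im → ellSlash m X G τ z = G τ z) :
    ∃ h : Fin (2 * m) → ℂ → ℂ, (∀ i, DifferentiableOn ℂ (h i) {τ | 0 < τ.im}) ∧
      ∀ τ z : ℂ, 0 < τ.im → G τ z = ∑ i, h i τ * thetaFn m i τ z := by
  set b : ℤ → ℂ → ℂ := fun n τ =>
    fcoef (G τ) n * cexp (-(Real.pi * I * (n : ℂ) ^ 2 * τ / (2 * m))) with hb
  refine ⟨fun i => b i, fun i => (differentiableOn_fcoef hG _).mul (by fun_prop), ?_⟩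
  intro τ z hτ
  have hper : ∀ z, G τ (z + 1) = G τ z := fun z => by simpa [ellSlash] using hs (0, 1) τ z hτ
  have hq : ∀ z, cexp (2 * Real.pi * I * m * (τ + 2 * z)) * G τ (z + τ) = G τ z := fun z => by
    simpa [ellSlash] using hs (1, 0) τ z hτ
  have hGd := differentiable_slice hG hτ
  have hbper := eq_of_add_two_mul_eq (b := fun n => b n τ) (fcoef_quasiperiodic hGd hper hm hq)
  have hθ : Differentiable ℂ fun z => ∑ i : Fin (2 * m), b i τ * thetaFn m i τ z := by
    have := fun i : Fin (2 * m) => differentiable_thetaFn hm i hτ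
    fun_prop
  have hθper : ∀ (i : Fin (2 * m)) z, thetaFn m i τ (z + 1) = thetaFn m i τ z := fun i z => by
    simpa [ellSlash] using thetaFn_slash m i (0, 1) τ z
  rw [← sub_eq_zero]
  refine eq_zero_of_fcoef_eq_zero (g := fun z => G τ z - ∑ i : Fin (2 * m), b i τ * thetaFn m i τ z)
    (hGd.sub hθ) (fun z => by simp only [hper, hθper]) (fun n => ?_) z
  rw [fcoef_sub hGd.continuous hθ.continuous, sub_eq_zero]
  have hpos : (0 : ℤ) < 2 * m := by omega
  let ν : Fin (2 * m) := ⟨(n % (2 * m)).toNat, by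
    have := Int.emod_lt_of_pos n hpos
    omega⟩
  have hν : ((ν : ℕ) : ℤ) = n % (2 * m) := Int.toNat_of_nonneg (Int.emod_nonneg n hpos.ne')
  have hn : n = ν + 2 * m * (n / (2 * m)) := by
    rw [hν]
    exact (Int.emod_add_mul_ediv n (2 * m)).symm
  have h1 := hbper ν (n / (2 * m))
  rw [hn, fcoef_sum_thetaFn hm (fun i : Fin (2 * m) => b i τ) hτ ν (n / (2 * m))]
  rw [← h1]
  simp only [hb]
  rw [mul_assoc (fcoef _ _), ← Complex.exp_add, neg_add_cancel, Complex.exp_zero, mul_one]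

/-! ### Polynomials on the upper half-plane -/

theorem exists_eq_sum_pow_of_iterate_deriv_eq_zero (r : ℕ) {h : ℂ → ℂ}
    (hd : DifferentiableOn ℂ h {τ | 0 < τ.im}) (h0 : ∀ τ : ℂ, 0 < τ.im → deriv^[r] h τ = 0) :
    ∃ a : Fin r → ℂ, ∀ τ : ℂ, 0 < τ.im → h τ = ∑ j, a j * τ ^ (j : ℕ) := by
  induction r generalizing h with
  | zero => exact ⟨0, fun τ hτ => by simpa using h0 τ hτ⟩
  | succ r ih =>
    obtain ⟨a, ha⟩ := ih (hd.deriv isOpen_im_pos) h0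
    set q : ℂ → ℂ := fun τ => ∑ j : Fin r, a j / (j + 1) * τ ^ (j + 1 : ℕ) with hq
    have hqd : ∀ τ, HasDerivAt q (∑ j, a j * τ ^ (j : ℕ)) τ := by
      intro τ
      refine HasDerivAt.fun_sum fun j _ => ?_
      refine ((hasDerivAt_pow (j + 1 : ℕ) τ).const_mul _).congr_deriv ?_
      have : (j + 1 : ℂ) ≠ 0 := by exact_mod_cast Nat.succ_ne_zero j
      push_cast
      field_simp
    have hdiff : ∀ τ : ℂ, 0 < τ.im → HasDerivAt (fun τ => h τ - q τ) 0 τ := by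
      intro τ hτ
      have h1 := (hd.differentiableAt (isOpen_im_pos.mem_nhds hτ)).hasDerivAt.sub (hqd τ)
      rwa [ha τ hτ, sub_self] at h1
    obtain ⟨C, hC⟩ := isOpen_im_pos.exists_is_const_of_deriv_eq_zero
      (convex_halfSpace_im_gt 0).isPreconnected
      (fun τ hτ => (hdiff τ hτ).differentiableAt.differentiableWithinAt)
      (fun τ hτ => (hdiff τ hτ).deriv)
    refine ⟨Fin.cons C fun j => a j / (j + 1), fun τ hτ => ?_⟩
    rw [Fin.sum_univ_succ]
    simp only [Fin.cons_zero, Fin.cons_succ, Fin.val_zero, pow_zero, mul_one, Fin.val_succ]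
    exact sub_eq_iff_eq_add.1 (hC τ hτ)

theorem iterate_deriv_sum_pow (r : ℕ) (a : Fin r → ℂ) (τ : ℂ) :
    deriv^[r] (fun τ => ∑ j, a j * τ ^ (j : ℕ)) τ = 0 := by
  let p : Polynomial ℂ := ∑ j : Fin r, Polynomial.C (a j) * Polynomial.X ^ (j : ℕ)
  have hp : (fun τ => ∑ j, a j * τ ^ (j : ℕ)) = fun τ => p.eval τ := by
    ext τ
    simp [p, Polynomial.eval_finsetSum]
  have hit : ∀ (n : ℕ) (q : Polynomial ℂ),
      deriv^[n] (fun τ => q.eval τ) = fun τ => (Polynomial.derivative^[n] q).eval τ := by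
    intro n
    induction n with
    | zero => intro q; rfl
    | succ n ih =>
      intro q
      rw [Function.iterate_succ_apply, Function.iterate_succ_apply, ← ih]
      congr 1
      ext τ
      exact q.deriv
  rw [hp, hit]
  simp only
  rw [Polynomial.iterate_derivative_eq_zero_of_degree_lt, Polynomial.eval_zero]
  exact Polynomial.degree_sum_fin_lt a

theorem sum_pow_injective {r : ℕ} {a a' : Fin r → ℂ}
    (h : ∀ τ : ℂ, 0 < τ.im → ∑ j, a j * τ ^ (j : ℕ) = ∑ j, a' j * τ ^ (j : ℕ)) : a = a' := by
  let p : (Fin r → ℂ) → Polynomial ℂ := fun a =>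
    ∑ j : Fin r, Polynomial.C (a j) * Polynomial.X ^ (j : ℕ)
  have hp : p a = p a' := by
    refine Polynomial.eq_of_infinite_eval_eq _ _
      (Set.Infinite.mono (s := {τ : ℂ | 0 < τ.im}) (fun τ hτ => ?_)
        (infinite_of_mem_nhds I (isOpen_im_pos.mem_nhds (by simp))))
    simpa [p, Polynomial.eval_finsetSum] using h τ hτ
  ext j
  have hc := congrArg (fun q => Polynomial.coeff q (j : ℕ)) hp
  simpa [p, Polynomial.finsetSum_coeff, Polynomial.coeff_X_pow, Fin.val_inj] using hc

/-! ### The heat operator on combinations of theta functions -/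

theorem wder_eq_deriv {f : ℂ → ℂ} {w : ℂ} (hf : DifferentiableAt ℂ f w) :
    wder f w = deriv f w := by
  have h : fderiv ℝ f w = (fderiv ℂ f w).restrictScalars ℝ :=
    (hf.hasFDerivAt.restrictScalars ℝ).fderiv
  have hI : fderiv ℂ f w I = I * deriv f w := by
    rw [← fderiv_apply_one_eq_deriv, ← smul_eq_mul, ← map_smul]
    simp
  rw [wder, h]
  simp only [ContinuousLinearMap.coe_restrictScalars', hI, fderiv_apply_one_eq_deriv]
  linear_combination (-(deriv f w) / 2) * I_mul_I

theorem heatOp_congr (m : ℕ) {F F' : ℂ → ℂ → ℂ} (h : ∀ τ z : ℂ, 0 < τ.im → F τ z = F' τ z)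
    {τ : ℂ} (hτ : 0 < τ.im) (z : ℂ) : heatOp m F τ z = heatOp m F' τ z := by
  have h1 : (fun w => F w z) =ᶠ[nhds τ] fun w => F' w z := by
    filter_upwards [isOpen_im_pos.mem_nhds hτ] with w hw using h w z hw
  have h2 : F τ = F' τ := funext fun z => h τ z hτ
  simp only [heatOp, h2, wder, h1.fderiv_eq]

theorem heatOp_sum_thetaFn {m : ℕ} (hm : 1 ≤ m) {h : Fin (2 * m) → ℂ → ℂ}
    (hd : ∀ i, DifferentiableOn ℂ (h i) {τ | 0 < τ.im}) {τ : ℂ} (hτ : 0 < τ.im) (z : ℂ) :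
    heatOp m (fun τ z => ∑ i, h i τ * thetaFn m i τ z) τ z =
      ∑ i, 8 * Real.pi * I * m * deriv (h i) τ * thetaFn m i τ z := by
  choose d hdτ hdz using fun i : Fin (2 * m) => hasDerivAt_thetaFn_tau hm i hτ z
  have hθ := fun i : Fin (2 * m) => differentiable_thetaFn hm i hτ
  have hθ' : ∀ i : Fin (2 * m), Differentiable ℂ (deriv (thetaFn m i τ)) := fun i =>
    differentiableOn_univ.1 ((hθ i).differentiableOn.deriv isOpen_univ)
  have hτd : HasDerivAt (fun w => ∑ i, h i w * thetaFn m i w z)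
      (∑ i, (deriv (h i) τ * thetaFn m i τ z + h i τ * d i)) τ :=
    HasDerivAt.fun_sum fun i _ =>
      ((hd i).differentiableAt (isOpen_im_pos.mem_nhds hτ)).hasDerivAt.mul (hdτ i)
  have hz1 : ∀ y, HasDerivAt (fun z => ∑ i, h i τ * thetaFn m i τ z)
      (∑ i, h i τ * deriv (thetaFn m i τ) y) y := fun y =>
    HasDerivAt.fun_sum fun i _ => ((hθ i).differentiableAt.hasDerivAt).const_mul _
  have hz2 : HasDerivAt (fun z => ∑ i, h i τ * deriv (thetaFn m i τ) z)
      (∑ i, h i τ * deriv (deriv (thetaFn m i τ)) z) z :=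
    HasDerivAt.fun_sum fun i _ => ((hθ' i).differentiableAt.hasDerivAt).const_mul _
  have hw1 : wder (fun z => ∑ i, h i τ * thetaFn m i τ z) =
      fun z => ∑ i, h i τ * deriv (thetaFn m i τ) z := by
    ext y
    rw [wder_eq_deriv (hz1 y).differentiableAt, (hz1 y).deriv]
  simp only [heatOp]
  rw [wder_eq_deriv hτd.differentiableAt, hτd.deriv, hw1, wder_eq_deriv hz2.differentiableAt,
    hz2.deriv, Finset.mul_sum, ← Finset.sum_sub_distrib]
  refine Finset.sum_congr rfl fun i _ => ?_
  rw [hdz]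
  ring

theorem differentiableOn_iterate_deriv {h : ℂ → ℂ} (hd : DifferentiableOn ℂ h {τ | 0 < τ.im})
    (r : ℕ) : DifferentiableOn ℂ (deriv^[r] h) {τ | 0 < τ.im} := by
  induction r with
  | zero => exact hd
  | succ r ih =>
    rw [Function.iterate_succ_apply']
    exact ih.deriv isOpen_im_pos

theorem iterate_heatOp_eq_sum_thetaFn {m : ℕ} (hm : 1 ≤ m) {h : Fin (2 * m) → ℂ → ℂ}
    (hd : ∀ i, DifferentiableOn ℂ (h i) {τ | 0 < τ.im}) {F : ℂ → ℂ → ℂ}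
    (hF : ∀ τ z : ℂ, 0 < τ.im → F τ z = ∑ i, h i τ * thetaFn m i τ z) (r : ℕ) (τ z : ℂ)
    (hτ : 0 < τ.im) :
    (heatOp m)^[r] F τ z =
      ∑ i, (8 * Real.pi * I * m) ^ r * deriv^[r] (h i) τ * thetaFn m i τ z := by
  induction r generalizing τ z with
  | zero => simpa using hF τ z hτ
  | succ r ih =>
    have hdr := fun i => differentiableOn_iterate_deriv (hd i) r
    rw [Function.iterate_succ_apply', heatOp_congr m ih hτ z,
      heatOp_sum_thetaFn hm (h := fun i τ => (8 * Real.pi * I * m) ^ r * deriv^[r] (h i) τ)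
        (fun i => (hdr i).const_mul _) hτ z]
    refine Finset.sum_congr rfl fun i _ => ?_
    rw [deriv_const_mul _ ((hdr i).differentiableAt (isOpen_im_pos.mem_nhds hτ)),
      Function.iterate_succ_apply']
    ring

/-- Elements of `Pkm k m` are the combinations of theta functions whose coefficients are
polynomials in `τ` of degree less than `k - 1`. -/
theorem mem_Pkm_iff {k m : ℕ} (hm : 1 ≤ m) {F : ℂ → ℂ → ℂ} :
    F ∈ Pkm k m ↔ ∃ a : Fin (2 * m) → Fin (k - 1) → ℂ, ∀ τ z : ℂ, 0 < τ.im →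
      F τ z = ∑ i, (∑ j, a i j * τ ^ (j : ℕ)) * thetaFn m i τ z := by
  constructor
  · rintro ⟨hd, hs, hh⟩
    obtain ⟨h, hhd, hF⟩ := exists_eq_sum_thetaFn hm hd hs
    have hc : (8 * Real.pi * I * m : ℂ) ≠ 0 := by
      have : (m : ℂ) ≠ 0 := by exact_mod_cast (by omega : m ≠ 0)
      simp [Real.pi_ne_zero, this]
    have h0 : ∀ i (τ : ℂ), 0 < τ.im → deriv^[k - 1] (h i) τ = 0 := by
      intro i τ hτ
      have hinj := sum_thetaFn_injective hm (τ := τ) (g' := fun _ => 0)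
        (g := fun i => (8 * Real.pi * I * m) ^ (k - 1) * deriv^[k - 1] (h i) τ) hτ fun z => by
          rw [← iterate_heatOp_eq_sum_thetaFn hm hhd hF (k - 1) τ z hτ, hh τ z hτ]
          simp
      exact (mul_eq_zero.1 (congrFun hinj i)).resolve_left (pow_ne_zero _ hc)
    choose a ha using fun i => exists_eq_sum_pow_of_iterate_deriv_eq_zero (k - 1) (hhd i) (h0 i)
    refine ⟨a, fun τ z hτ => (hF τ z hτ).trans (Finset.sum_congr rfl fun i _ => ?_)⟩
    rw [ha i τ hτ]
  · rintro ⟨a, ha⟩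
    refine ⟨?_, fun X τ z hτ => ?_, fun τ z hτ => ?_⟩
    · have hsum : DifferentiableOn ℂ (fun p : ℂ × ℂ =>
          ∑ i, (∑ j, a i j * p.1 ^ (j : ℕ)) * thetaFn m i p.1 p.2) {p : ℂ × ℂ | 0 < p.1.im} :=
        DifferentiableOn.fun_sum fun i _ => DifferentiableOn.mul (by fun_prop)
          (differentiableOn_thetaFn hm i)
      exact hsum.congr fun p hp => ha p.1 p.2 hp
    · rw [ellSlash, ha _ _ hτ, ha _ _ hτ, Finset.mul_sum]
      refine Finset.sum_congr rfl fun i _ => ?_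
      rw [← thetaFn_slash m i X τ z, ellSlash]
      ring
    · rw [iterate_heatOp_eq_sum_thetaFn hm (h := fun i τ => ∑ j, a i j * τ ^ (j : ℕ))
        (fun i => by fun_prop) ha (k - 1) τ z hτ]
      simp [iterate_deriv_sum_pow]

/-- `P_{k−2,m}` is a complex vector space of dimension `2m(k−1)`:
it is closed under addition and scalar multiplication, and there are `2m(k−1)`
elements of `P_{k−2,m}` through which every element of `P_{k−2,m}` is expressed,
uniquely, as a linear combination (on `ℍ × ℂ`). -/
theorem Pkm_dimension (k m : ℕ) (hk : 2 ≤ k) (hm : 1 ≤ m) :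
    (∀ G ∈ Pkm k m, ∀ H ∈ Pkm k m, G + H ∈ Pkm k m) ∧
    (∀ (c : ℂ), ∀ G ∈ Pkm k m, c • G ∈ Pkm k m) ∧
    ∃ B : Fin (2 * m * (k - 1)) → (ℂ → ℂ → ℂ),
      (∀ i, B i ∈ Pkm k m) ∧
      ∀ G ∈ Pkm k m, ∃! c : Fin (2 * m * (k - 1)) → ℂ,
        ∀ τ z : ℂ, 0 < τ.im →
          G τ z = ∑ i : Fin (2 * m * (k - 1)), c i * B i τ z := by
  refine ⟨fun G hG H hH => ?_, fun c G hG => ?_, ?_⟩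
  · obtain ⟨a, ha⟩ := (mem_Pkm_iff hm).1 hG
    obtain ⟨b, hb⟩ := (mem_Pkm_iff hm).1 hH
    refine (mem_Pkm_iff hm).2 ⟨a + b, fun τ z hτ => ?_⟩
    simp only [Pi.add_apply, ha τ z hτ, hb τ z hτ, add_mul, Finset.sum_add_distrib]
  · obtain ⟨a, ha⟩ := (mem_Pkm_iff hm).1 hG
    refine (mem_Pkm_iff hm).2 ⟨c • a, fun τ z hτ => ?_⟩
    simp only [Pi.smul_apply, smul_eq_mul, ha τ z hτ, Finset.mul_sum, Finset.sum_mul, mul_assoc]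
  · let e : Fin (2 * m) × Fin (k - 1) ≃ Fin (2 * m * (k - 1)) := finProdFinEquiv
    let B : Fin (2 * m * (k - 1)) → ℂ → ℂ → ℂ := fun i τ z =>
      τ ^ ((e.symm i).2 : ℕ) * thetaFn m (e.symm i).1 τ z
    have hB : ∀ (c : Fin (2 * m * (k - 1)) → ℂ) (τ z : ℂ), ∑ i, c i * B i τ z =
        ∑ i, (∑ j, c (e (i, j)) * τ ^ (j : ℕ)) * thetaFn m i τ z := by
      intro c τ z
      rw [← Equiv.sum_comp e, Fintype.sum_prod_type]
      simp only [B, Equiv.symm_apply_apply, Finset.sum_mul, mul_assoc]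
    refine ⟨B, fun i => (mem_Pkm_iff hm).2 ⟨fun ν j => (Pi.single i (1 : ℂ) :
      Fin (2 * m * (k - 1)) → ℂ) (e (ν, j)), fun τ z _ => ?_⟩, fun G hG => ?_⟩
    · rw [← hB]
      simp [Pi.single_apply]
    · obtain ⟨a, ha⟩ := (mem_Pkm_iff hm).1 hG
      refine ⟨fun i => a (e.symm i).1 (e.symm i).2, fun τ z hτ => ?_, fun c hc => ?_⟩
      · simp only [hB, Equiv.symm_apply_apply, ha τ z hτ]
      · have hcoef : ∀ ν, (fun j => c (e (ν, j))) = a ν := by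
          intro ν
          refine sum_pow_injective fun τ hτ => ?_
          exact congrFun (sum_thetaFn_injective hm (τ := τ)
            (g := fun ν => ∑ j, c (e (ν, j)) * τ ^ (j : ℕ))
            (g' := fun ν => ∑ j, a ν j * τ ^ (j : ℕ)) hτ fun z => by
              rw [← hB, ← hc τ z hτ, ha τ z hτ]) ν
        ext i
        rw [← hcoef]
        simp
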